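/- arXiv:math/0109097 — 3 statements merged into one kernel-verified Lean document; each statement's English description precedes it below -/
import Mathlib

section
/- Fix ε ∈ ℝ. In coordinates (x¹,x²) = (r,θ), consider the Riemannian metric with a₁₁(r) = 1/((1−(1+ε²)r²)(1−r²)), a₁₂ = a₂₁ = 0, a₂₂(r) = r²(1−r²)/(1−(1+ε²)r²)², and the 1-form with b₁ = 0, b₂(r) = −εr²/(1−(1+ε²)r²). Then for every r with 0 < r < 1/√(1+ε²), the tensor e_{ij} := r_{ij} + b_i s_j + b_j s_i vanishes identically: e_{ij} = 0 for all i, j ∈ {1,2}. (This is equivalent to the vanishing of the S-curvature of the Randers metric F = α + β.) -/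
noncomputable section

/-- Partial derivative in coordinates `(x¹,x²) = (r,θ)` for data depending only
on `r`: `∂/∂x¹ = d/dr` and `∂/∂x² = 0`. -/
def pder (i : Fin 2) (f : ℝ → ℝ) : ℝ → ℝ := if i = 0 then deriv f else 0

/-- The inverse `(a^{ij})` of the metric coefficient matrix `(a_{ij})`. -/
def aInv (a : Fin 2 → Fin 2 → ℝ → ℝ) (r : ℝ) : Matrix (Fin 2) (Fin 2) ℝ :=
  (Matrix.of fun i j => a i j r)⁻¹

/-- Christoffel symbols `Γ^k_{ij} = ½ a^{kl}(∂_i a_{jl} + ∂_j a_{il} − ∂_l a_{ij})`. -/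
def christoffel (a : Fin 2 → Fin 2 → ℝ → ℝ) (k i j : Fin 2) (r : ℝ) : ℝ :=
  (1 / 2) * ∑ l, aInv a r k l * (pder i (a j l) r + pder j (a i l) r - pder l (a i j) r)

/-- Covariant derivative `b_{i|j} = ∂b_i/∂x^j − b_k Γ^k_{ij}`. -/
def bcov (a : Fin 2 → Fin 2 → ℝ → ℝ) (b : Fin 2 → ℝ → ℝ) (i j : Fin 2) (r : ℝ) : ℝ :=
  pder j (b i) r - ∑ k, b k r * christoffel a k i j r

/-- `r_{ij} = ½(b_{i|j} + b_{j|i})`. -/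
def rTensor (a : Fin 2 → Fin 2 → ℝ → ℝ) (b : Fin 2 → ℝ → ℝ) (i j : Fin 2) (r : ℝ) : ℝ :=
  (1 / 2) * (bcov a b i j r + bcov a b j i r)

/-- `s_{ij} = ½(b_{i|j} − b_{j|i})`. -/
def sTensor (a : Fin 2 → Fin 2 → ℝ → ℝ) (b : Fin 2 → ℝ → ℝ) (i j : Fin 2) (r : ℝ) : ℝ :=
  (1 / 2) * (bcov a b i j r - bcov a b j i r)

/-- `s^i_j = a^{ih} s_{hj}`. -/
def sUp (a : Fin 2 → Fin 2 → ℝ → ℝ) (b : Fin 2 → ℝ → ℝ) (i j : Fin 2) (r : ℝ) : ℝ :=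
  ∑ h, aInv a r i h * sTensor a b h j r

/-- `s_j = b_i s^i_j`. -/
def sLow (a : Fin 2 → Fin 2 → ℝ → ℝ) (b : Fin 2 → ℝ → ℝ) (j : Fin 2) (r : ℝ) : ℝ :=
  ∑ i, b i r * sUp a b i j r

/-- `e_{ij} = r_{ij} + b_i s_j + b_j s_i`. -/
def eTensor (a : Fin 2 → Fin 2 → ℝ → ℝ) (b : Fin 2 → ℝ → ℝ) (i j : Fin 2) (r : ℝ) : ℝ :=
  rTensor a b i j r + b i r * sLow a b j r + b j r * sLow a b i r

end

lemma aInv_of_diagonal {a : Fin 2 → Fin 2 → ℝ → ℝ} {r : ℝ} (h01 : a 0 1 = 0) (h10 : a 1 0 = 0)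
    (h0 : a 0 0 r ≠ 0) (h1 : a 1 1 r ≠ 0) :
    aInv a r = !![(a 0 0 r)⁻¹, 0; 0, (a 1 1 r)⁻¹] := by
  refine Matrix.inv_eq_right_inv ?_
  ext i j
  fin_cases i <;> fin_cases j <;> simp [Matrix.mul_apply, h01, h10, h0, h1]

/-- For a diagonal metric and a form `b₂ dθ`, with coefficients depending only on `r`,
the tensor `e` is purely off-diagonal. -/
lemma eTensor_of_diagonal {a : Fin 2 → Fin 2 → ℝ → ℝ} {b : Fin 2 → ℝ → ℝ} {r : ℝ}
    (h01 : a 0 1 = 0) (h10 : a 1 0 = 0) (h0 : a 0 0 r ≠ 0) (h1 : a 1 1 r ≠ 0) (hb : b 0 = 0)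
    (i j : Fin 2) :
    eTensor a b i j r = if i = j then 0 else
      deriv (b 1) r / 2 - b 1 r * (deriv (a 1 1) r / (2 * a 1 1 r)) +
        b 1 r ^ 2 * deriv (b 1) r / (2 * a 1 1 r) := by
  have hz : deriv (0 : ℝ → ℝ) r = 0 := by simp
  fin_cases i <;> fin_cases j <;>
    simp [eTensor, rTensor, sLow, sUp, sTensor, bcov, christoffel,
      aInv_of_diagonal h01 h10 h0 h1, pder, h01, h10, hb, hz] <;>
    field_simp <;> ring

/-- For the Randers data `(α, β)` on the disk `D²(1/√(1+ε²))` obtained from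
Zermelo navigation on the Klein metric, written in polar coordinates, the tensor
`e_{ij}` vanishes; this is equivalent to the vanishing of the S-curvature of
`F = α + β`. -/
theorem eTensor_vanishes_klein_navigation (ε : ℝ)
    (a : Fin 2 → Fin 2 → ℝ → ℝ) (b : Fin 2 → ℝ → ℝ)
    (ha : a = fun i j r =>
      !![1 / ((1 - (1 + ε ^ 2) * r ^ 2) * (1 - r ^ 2)), 0;
         0, r ^ 2 * (1 - r ^ 2) / (1 - (1 + ε ^ 2) * r ^ 2) ^ 2] i j)
    (hb : b = fun i r => ![0, -ε * r ^ 2 / (1 - (1 + ε ^ 2) * r ^ 2)] i) :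
    ∀ r : ℝ, 0 < r → r < 1 / Real.sqrt (1 + ε ^ 2) →
      ∀ i j : Fin 2, eTensor a b i j r = 0 := by
  subst ha hb
  intro r hr0 hr i j
  have hk : 0 < 1 + ε ^ 2 := by positivity
  have hP : 0 < 1 - (1 + ε ^ 2) * r ^ 2 := by
    have h : r * √(1 + ε ^ 2) < 1 := (lt_div_iff₀ (Real.sqrt_pos.2 hk)).1 hr
    have h2 : (r * √(1 + ε ^ 2)) ^ 2 < 1 := by
      rw [sq_lt_one_iff₀ (by positivity)]
      exact h
    rw [mul_pow, Real.sq_sqrt hk.le] at h2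
    linarith
  have hQ : 0 < 1 - r ^ 2 := by nlinarith [mul_nonneg (sq_nonneg ε) (sq_nonneg r)]
  have hsq : HasDerivAt (fun x : ℝ => x ^ 2) (2 * r) r := by
    simpa using hasDerivAt_pow 2 r
  have hdP := (hsq.const_mul (1 + ε ^ 2)).const_sub 1
  have hdQ := hsq.const_sub 1
  have hdB : deriv (fun r => -ε * r ^ 2 / (1 - (1 + ε ^ 2) * r ^ 2)) r = _ :=
    ((hsq.const_mul (-ε)).fun_div hdP hP.ne').deriv
  have hdC : deriv (fun r => r ^ 2 * (1 - r ^ 2) / (1 - (1 + ε ^ 2) * r ^ 2) ^ 2) r = _ :=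
    ((hsq.fun_mul hdQ).fun_div (hdP.fun_pow 2) (pow_ne_zero 2 hP.ne')).deriv
  rw [eTensor_of_diagonal (by ext; simp) (by ext; simp) (by simp [hP.ne', hQ.ne'])
    (by simp [hP.ne', hQ.ne', hr0.ne']) (by ext; simp)]
  simp only [Matrix.of_apply, Matrix.cons_val_one, Matrix.cons_val_fin_one]
  rw [hdB, hdC]
  split_ifs
  · rfl
  · have hP' := hP.ne'
    have hQ' := hQ.ne'
    field_simp
    ring
end

section
/- Fix ε ∈ ℝ. In coordinates (x¹,x²) = (r,θ), consider the Riemannian metric with a₁₁(r) = (1−ε²r²)/(1−(1+ε²)r²)², a₁₂(r) = a₂₁(r) = −εr³/(1−(1+ε²)r²)², a₂₂(r) = r²(1−r²)/(1−(1+ε²)r²)², and the 1-form with b₁(r) = r/(1−(1+ε²)r²), b₂(r) = −εr²/(1−(1+ε²)r²). Then for every r with 0 < r < 1/√(1+ε²), the tensor e_{ij} := r_{ij} + b_i s_j + b_j s_i satisfies e_{ij} = a_{ij} − b_i b_j for all i, j ∈ {1,2}. (This is equivalent to the S-curvature identity S = (3/2)F for the Randers metric F = α + β.) -/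
theorem Matrix.inv_of_fin_two_symm {m : Fin 2 → Fin 2 → ℝ} {p q s : ℝ}
    (h₀ : m 0 0 * p + m 0 1 * q = 1) (h₁ : m 0 0 * q + m 0 1 * s = 0)
    (h₂ : m 1 0 * p + m 1 1 * q = 0) (h₃ : m 1 0 * q + m 1 1 * s = 1) :
    (Matrix.of m)⁻¹ = !![p, q; q, s] := by
  apply Matrix.inv_eq_right_inv
  ext i j
  fin_cases i <;> fin_cases j <;> simpa [Matrix.mul_apply, Fin.sum_univ_two]

theorem hasDerivAt_one_sub_mul_sq (k r : ℝ) :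
    HasDerivAt (fun x : ℝ => 1 - k * x ^ 2) (-(2 * k * r)) r := by
  refine (((hasDerivAt_pow 2 r).const_mul k).const_sub 1).congr_deriv ?_
  norm_num
  ring

theorem one_sub_mul_sq_pos {k r : ℝ} (hk : 0 < k) (hr : 0 < r) (h : r < 1 / √k) :
    0 < 1 - k * r ^ 2 := by
  have hs := Real.sqrt_pos.2 hk
  have h' : r * √k < 1 := (lt_div_iff₀ hs).1 h
  nlinarith [Real.sq_sqrt hk.le, mul_pos hr hs]

/-- For the Randers data `(α, β)` on the disk `D²(1/√(1+ε²))` obtained from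
Zermelo navigation on the Funk metric of the unit disk, written in polar
coordinates, the tensor `e_{ij}` equals `a_{ij} − b_i b_j`; this is equivalent
to the S-curvature identity `S = (3/2)F` for the Randers metric `F = α + β`. -/
theorem eTensor_funk_navigation (ε : ℝ)
    (a : Fin 2 → Fin 2 → ℝ → ℝ) (b : Fin 2 → ℝ → ℝ)
    (ha : a = fun i j r =>
      !![(1 - ε ^ 2 * r ^ 2) / (1 - (1 + ε ^ 2) * r ^ 2) ^ 2,
         -ε * r ^ 3 / (1 - (1 + ε ^ 2) * r ^ 2) ^ 2;
         -ε * r ^ 3 / (1 - (1 + ε ^ 2) * r ^ 2) ^ 2,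
         r ^ 2 * (1 - r ^ 2) / (1 - (1 + ε ^ 2) * r ^ 2) ^ 2] i j)
    (hb : b = fun i r =>
      ![r / (1 - (1 + ε ^ 2) * r ^ 2), -ε * r ^ 2 / (1 - (1 + ε ^ 2) * r ^ 2)] i) :
    ∀ r : ℝ, 0 < r → r < 1 / Real.sqrt (1 + ε ^ 2) →
      ∀ i j : Fin 2, eTensor a b i j r = a i j r - b i r * b j r := by
  intro r hr hrlt i j
  have hD : 1 - (1 + ε ^ 2) * r ^ 2 ≠ 0 :=
    (one_sub_mul_sq_pos (by positivity) hr hrlt).ne'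
  have hD' : 1 - r ^ 2 * (1 + ε ^ 2) ≠ 0 := by rwa [mul_comm (r ^ 2)]
  have hr0 : r ≠ 0 := hr.ne'
  have hd := hasDerivAt_one_sub_mul_sq (1 + ε ^ 2) r
  have ha00 : deriv (a 0 0) r = -(2 * ε ^ 2 * r) / (1 - (1 + ε ^ 2) * r ^ 2) ^ 2
      + 4 * (1 + ε ^ 2) * r * (1 - ε ^ 2 * r ^ 2) / (1 - (1 + ε ^ 2) * r ^ 2) ^ 3 := by
    subst ha
    refine HasDerivAt.deriv (((hasDerivAt_one_sub_mul_sq (ε ^ 2) r).div (hd.pow 2)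
      (pow_ne_zero 2 hD)).congr_deriv ?_)
    simp only [Pi.pow_apply]
    field_simp
    ring
  have ha01 : deriv (a 0 1) r = -(3 * ε * r ^ 2) / (1 - (1 + ε ^ 2) * r ^ 2) ^ 2
      - 4 * (1 + ε ^ 2) * ε * r ^ 4 / (1 - (1 + ε ^ 2) * r ^ 2) ^ 3 := by
    subst ha
    refine HasDerivAt.deriv ((((hasDerivAt_pow 3 r).const_mul (-ε)).div (hd.pow 2)
      (pow_ne_zero 2 hD)).congr_deriv ?_)
    simp only [Pi.pow_apply]
    field_simp
    ring
  have ha10 : a 1 0 = a 0 1 := by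
    subst ha
    rfl
  have ha11 : deriv (a 1 1) r = (2 * r - 4 * r ^ 3) / (1 - (1 + ε ^ 2) * r ^ 2) ^ 2
      + 4 * (1 + ε ^ 2) * r ^ 3 * (1 - r ^ 2) / (1 - (1 + ε ^ 2) * r ^ 2) ^ 3 := by
    subst ha
    refine HasDerivAt.deriv ((((hasDerivAt_pow 2 r).mul ((hasDerivAt_pow 2 r).const_sub 1)).div
      (hd.pow 2) (pow_ne_zero 2 hD)).congr_deriv ?_)
    simp only [Pi.pow_apply, Pi.mul_apply]
    field_simp
    ring
  have hb0 : deriv (b 0) r = (1 + (1 + ε ^ 2) * r ^ 2) / (1 - (1 + ε ^ 2) * r ^ 2) ^ 2 := by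
    subst hb
    refine HasDerivAt.deriv (((hasDerivAt_id r).div hd hD).congr_deriv ?_)
    simp only [id]
    field_simp
    ring
  have hb1 : deriv (b 1) r = -(2 * ε * r) / (1 - (1 + ε ^ 2) * r ^ 2) ^ 2 := by
    subst hb
    refine HasDerivAt.deriv ((((hasDerivAt_pow 2 r).const_mul (-ε)).div hd hD).congr_deriv ?_)
    field_simp
    ring
  have hinv : aInv a r = !![(1 - r ^ 2) * (1 - (1 + ε ^ 2) * r ^ 2),
      ε * r * (1 - (1 + ε ^ 2) * r ^ 2); ε * r * (1 - (1 + ε ^ 2) * r ^ 2),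
      (1 - ε ^ 2 * r ^ 2) * (1 - (1 + ε ^ 2) * r ^ 2) / r ^ 2] := by
    subst ha
    apply Matrix.inv_of_fin_two_symm <;> simp <;> field_simp <;> ring
  have hbr0 : b 0 r = r / (1 - (1 + ε ^ 2) * r ^ 2) := by
    subst hb
    rfl
  have hbr1 : b 1 r = -ε * r ^ 2 / (1 - (1 + ε ^ 2) * r ^ 2) := by
    subst hb
    rfl
  have hbcov (i j : Fin 2) : bcov a b i j r = pder j (b i) r
      - (r * (1 - (1 + ε ^ 2) * r ^ 2) * (pder i (a j 0) r + pder j (a i 0) r - pder 0 (a i j) r)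
        - ε * (1 - (1 + ε ^ 2) * r ^ 2) *
          (pder i (a j 1) r + pder j (a i 1) r - pder 1 (a i j) r)) / 2 := by
    simp [bcov, christoffel, Fin.sum_univ_two, hinv, hbr0, hbr1]
    field_simp
    ring
  have hsLow (j : Fin 2) : sLow a b j r = r * (1 - (1 + ε ^ 2) * r ^ 2) * sTensor a b 0 j r
      - ε * (1 - (1 + ε ^ 2) * r ^ 2) * sTensor a b 1 j r := by
    simp [sLow, sUp, Fin.sum_univ_two, hinv, hbr0, hbr1]
    field_simp
    ring
  have hm : a 0 0 r = (1 - ε ^ 2 * r ^ 2) / (1 - (1 + ε ^ 2) * r ^ 2) ^ 2 ∧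
      a 0 1 r = -ε * r ^ 3 / (1 - (1 + ε ^ 2) * r ^ 2) ^ 2 ∧
      a 1 1 r = r ^ 2 * (1 - r ^ 2) / (1 - (1 + ε ^ 2) * r ^ 2) ^ 2 := by
    subst ha
    exact ⟨rfl, rfl, rfl⟩
  obtain ⟨hm00, hm01, hm11⟩ := hm
  clear ha hb
  fin_cases i <;> fin_cases j <;>
  · simp [eTensor, rTensor, hsLow, sTensor, hbcov, pder, ha10, ha00, ha01, ha11, hb0, hb1, hbr0, hbr1,
      hm00, hm01, hm11]
    field_simp
    ring
end

section
/- Fix ε ∈ ℝ. On the domain of points (r,θ,μ,ν) with 0 < r < 1/√(1+ε²) and (μ,ν) ≠ (0,0), define F(r,θ,μ,ν) := (√((1−(1+ε²)r²)μ² + r²(1−r²)²ν²)/√(1−r²) − εr²ν)/(1−(1+ε²)r²). Then F > 0, the fundamental tensor (g_{ij}) of F is positive definite, and the Riemann curvature coefficients of F satisfy R^i_k = −(F²δ^i_k − F(∂F/∂y^k)y^i) for all i, k ∈ {1,2}; that is, F has constant flag curvature K = −1. -/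
noncomputable section

/-- Partial derivative in the base coordinate `x^i` of a function of `(x, y)`. -/
def pdx (i : Fin 2) (f : (Fin 2 → ℝ) → (Fin 2 → ℝ) → ℝ) :
    (Fin 2 → ℝ) → (Fin 2 → ℝ) → ℝ :=
  fun x y => deriv (fun t => f (Function.update x i t) y) (x i)

/-- Partial derivative in the fibre coordinate `y^i` of a function of `(x, y)`. -/
def pdy (i : Fin 2) (f : (Fin 2 → ℝ) → (Fin 2 → ℝ) → ℝ) :
    (Fin 2 → ℝ) → (Fin 2 → ℝ) → ℝ :=
  fun x y => deriv (fun t => f x (Function.update y i t)) (y i)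

/-- The fundamental tensor `g_{ij} = ½ ∂²(F²)/∂y^i∂y^j` of a Finsler metric `F`. -/
def fundTensor (F : (Fin 2 → ℝ) → (Fin 2 → ℝ) → ℝ) (i j : Fin 2) :
    (Fin 2 → ℝ) → (Fin 2 → ℝ) → ℝ :=
  fun x y => (1 / 2) * pdy i (pdy j fun x y => F x y ^ 2) x y

/-- The fundamental tensor as a matrix. -/
def fundMatrix (F : (Fin 2 → ℝ) → (Fin 2 → ℝ) → ℝ) (x y : Fin 2 → ℝ) :
    Matrix (Fin 2) (Fin 2) ℝ :=
  Matrix.of fun i j => fundTensor F i j x y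

/-- The geodesic (spray) coefficients
`G^i = ¼ g^{ik}(2 ∂g_{pk}/∂x^q − ∂g_{pq}/∂x^k) y^p y^q`. -/
def sprayCoeff (F : (Fin 2 → ℝ) → (Fin 2 → ℝ) → ℝ) (i : Fin 2) :
    (Fin 2 → ℝ) → (Fin 2 → ℝ) → ℝ :=
  fun x y => (1 / 4) * ∑ k, (fundMatrix F x y)⁻¹ i k *
    ∑ p, ∑ q, (2 * pdx q (fundTensor F p k) x y - pdx k (fundTensor F p q) x y) * y p * y q

/-- The Riemann curvature coefficients
`R^i_k = 2∂G^i/∂x^k − y^j ∂²G^i/∂x^j∂y^k + 2G^j ∂²G^i/∂y^j∂y^k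
  − (∂G^i/∂y^j)(∂G^j/∂y^k)`. -/
def riemCoeff (F : (Fin 2 → ℝ) → (Fin 2 → ℝ) → ℝ) (i k : Fin 2) :
    (Fin 2 → ℝ) → (Fin 2 → ℝ) → ℝ :=
  fun x y =>
    2 * pdx k (sprayCoeff F i) x y
      - ∑ j, y j * pdx j (pdy k (sprayCoeff F i)) x y
      + 2 * ∑ j, sprayCoeff F j x y * pdy j (pdy k (sprayCoeff F i)) x y
      - ∑ j, pdy j (sprayCoeff F i) x y * pdy k (sprayCoeff F j) x y

end

/-- The cone of triples `(r, μ, ν)` on which the navigation metric is smooth. -/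
def NavDomain (ε r a b : ℝ) : Prop :=
  0 < r ∧ 0 < 1 - (1 + ε ^ 2) * r ^ 2 ∧ (a ≠ 0 ∨ b ≠ 0)

/-- The normalised Riemannian part of the navigation metric. -/
noncomputable def navRoot (ε r a b : ℝ) : ℝ :=
  √((1 - (1 + ε ^ 2) * r ^ 2) * a ^ 2 + r ^ 2 * (1 - r ^ 2) ^ 2 * b ^ 2) / √(1 - r ^ 2)

/-- The navigation metric as a function of `(r, μ, ν)`. -/
noncomputable def navMetric (ε r a b : ℝ) : ℝ :=
  (navRoot ε r a b - ε * r ^ 2 * b) / (1 - (1 + ε ^ 2) * r ^ 2)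

/-- The angular velocity relative to the wind. -/
noncomputable def navAngular (ε r a b : ℝ) : ℝ := b - ε * navMetric ε r a b

namespace NavDomain

variable {ε r a b : ℝ}

theorem one_sub_sq_pos (h : NavDomain ε r a b) : 0 < 1 - r ^ 2 := by
  have := h.2.1
  nlinarith [mul_nonneg (sq_nonneg ε) (sq_nonneg r)]

theorem navRoot_sq (h : NavDomain ε r a b) :
    navRoot ε r a b ^ 2 * (1 - r ^ 2) =
      (1 - (1 + ε ^ 2) * r ^ 2) * a ^ 2 + r ^ 2 * (1 - r ^ 2) ^ 2 * b ^ 2 := by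
  have hw := h.one_sub_sq_pos
  have hD := h.2.1
  rw [navRoot, div_pow, Real.sq_sqrt (by positivity), Real.sq_sqrt hw.le]
  field_simp

theorem navRoot_pos (h : NavDomain ε r a b) : 0 < navRoot ε r a b := by
  have hw := h.one_sub_sq_pos
  obtain ⟨hr, hD, hab⟩ := h
  have : 0 < (1 - (1 + ε ^ 2) * r ^ 2) * a ^ 2 + r ^ 2 * (1 - r ^ 2) ^ 2 * b ^ 2 := by
    rcases hab with h | h <;> positivity
  unfold navRoot
  positivity

theorem navMetric_mul (h : NavDomain ε r a b) :
    navMetric ε r a b * (1 - (1 + ε ^ 2) * r ^ 2) = navRoot ε r a b - ε * r ^ 2 * b :=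
  div_mul_cancel₀ _ h.2.1.ne'

theorem navRoot_eq (h : NavDomain ε r a b) :
    navRoot ε r a b =
      navMetric ε r a b * (1 - r ^ 2) + ε * r ^ 2 * navAngular ε r a b := by
  unfold navAngular
  linear_combination -h.navMetric_mul

/-- The indicatrix equation: `F` is the Klein norm of `(μ, ν - ε F)`. -/
theorem navMetric_sq (h : NavDomain ε r a b) :
    navMetric ε r a b ^ 2 * (1 - r ^ 2) ^ 2 =
      a ^ 2 + r ^ 2 * (1 - r ^ 2) * navAngular ε r a b ^ 2 := by
  have hs := h.navRoot_sq
  rw [h.navRoot_eq] at hs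
  refine mul_left_cancel₀ h.2.1.ne' ?_
  unfold navAngular at *
  linear_combination hs

theorem navMetric_pos (h : NavDomain ε r a b) : 0 < navMetric ε r a b := by
  have hw := h.one_sub_sq_pos
  have hs := h.navRoot_sq
  have hs' := h.navRoot_pos
  obtain ⟨hr, hD, hab⟩ := h
  refine div_pos (sub_pos.2 (lt_of_pow_lt_pow_left₀ 2 hs'.le ?_)) hD
  have : 0 < (1 - (1 + ε ^ 2) * r ^ 2) * (a ^ 2 + r ^ 2 * (1 - r ^ 2) * b ^ 2) := by
    rcases hab with h | h <;> positivity
  refine lt_of_mul_lt_mul_right (a := 1 - r ^ 2) ?_ hw.le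
  linarith

section Curve

variable {R A B : ℝ → ℝ} {dr da db t : ℝ}

theorem hasDerivAt_navRoot (h : NavDomain ε (R t) (A t) (B t)) (hR : HasDerivAt R dr t)
    (hA : HasDerivAt A da t) (hB : HasDerivAt B db t) :
    HasDerivAt (fun t ↦ navRoot ε (R t) (A t) (B t))
      (((1 - (1 + ε ^ 2) * R t ^ 2) * A t / (1 - R t ^ 2) * da
        + R t ^ 2 * (1 - R t ^ 2) * B t * db
        + R t * ((1 - 2 * R t ^ 2) * B t ^ 2 - ε ^ 2 * A t ^ 2 / (1 - R t ^ 2) ^ 2) * dr)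
          / navRoot ε (R t) (A t) (B t)) t := by
  have hw := h.one_sub_sq_pos
  have hs := h.navRoot_sq
  have hs' := h.navRoot_pos
  obtain ⟨hr, hD, hab⟩ := h
  have hQ : 0 < (1 - (1 + ε ^ 2) * R t ^ 2) * A t ^ 2
      + R t ^ 2 * (1 - R t ^ 2) ^ 2 * B t ^ 2 := by
    rcases hab with h | h <;> positivity
  have key := ((((((hR.pow 2).const_mul (1 + ε ^ 2)).const_sub 1).mul (hA.pow 2)).add
    (((hR.pow 2).mul (((hR.pow 2).const_sub 1).pow 2)).mul (hB.pow 2))).sqrt hQ.ne').div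
      (((hR.pow 2).const_sub 1).sqrt hw.ne') (Real.sqrt_pos.2 hw).ne'
  refine key.congr_deriv ?_
  simp only [Pi.add_apply, Pi.mul_apply, Pi.pow_apply]
  unfold navRoot at *
  have hp := Real.sqrt_pos.2 hw
  have hp2 := Real.sq_sqrt hw.le
  have hq := Real.sqrt_pos.2 hQ
  have hq2 := Real.sq_sqrt hQ.le
  set p := √(1 - R t ^ 2)
  set q := √((1 - (1 + ε ^ 2) * R t ^ 2) * A t ^ 2 + R t ^ 2 * (1 - R t ^ 2) ^ 2 * B t ^ 2)
  have hw2 : 0 < p ^ 2 := by positivity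
  generalize hW : 1 - R t ^ 2 = w at *
  generalize hD' : 1 - (1 + ε ^ 2) * R t ^ 2 = D at *
  subst hp2
  field_simp
  norm_num
  subst hD'
  linear_combination (dr * R t) * hq2 + dr * R t * ((1 + ε ^ 2) * A t ^ 2 - p ^ 4 * B t ^ 2) * hW

theorem hasDerivAt_navMetric (h : NavDomain ε (R t) (A t) (B t)) (hR : HasDerivAt R dr t)
    (hA : HasDerivAt A da t) (hB : HasDerivAt B db t) :
    HasDerivAt (fun t ↦ navMetric ε (R t) (A t) (B t))
      ((R t * (2 * (1 - R t ^ 2) * navMetric ε (R t) (A t) (B t) ^ 2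
          + (1 - 2 * R t ^ 2) * navAngular ε (R t) (A t) (B t) ^ 2) * dr
        + A t * da + R t ^ 2 * (1 - R t ^ 2) * navAngular ε (R t) (A t) (B t) * db)
          / ((1 - R t ^ 2) * navRoot ε (R t) (A t) (B t))) t := by
  have hw := h.one_sub_sq_pos
  have hs' := h.navRoot_pos
  have key := ((h.hasDerivAt_navRoot hR hA hB).sub
    (((hR.pow 2).const_mul ε).mul hB)).div
      (((hR.pow 2).const_mul (1 + ε ^ 2)).const_sub 1) h.2.1.ne'
  refine key.congr_deriv ?_
  simp only [Pi.sub_apply, Pi.mul_apply, Pi.pow_apply]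
  have h1 := h.navRoot_eq
  have h2 := h.navMetric_sq
  have hD := h.2.1
  have hb : B t = navAngular ε (R t) (A t) (B t) + ε * navMetric ε (R t) (A t) (B t) := by
    unfold navAngular; ring
  generalize navRoot ε (R t) (A t) (B t) = s at *
  generalize navAngular ε (R t) (A t) (B t) = n at *
  generalize navMetric ε (R t) (A t) (B t) = f at *
  generalize R t = r at *
  generalize A t = a at *
  rw [hb]
  generalize hW : 1 - r ^ 2 = w at *
  generalize hD' : 1 - (1 + ε ^ 2) * r ^ 2 = D at *
  field_simp
  norm_num
  subst hD' hW h1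
  linear_combination (ε ^ 2 * (1 - (1 + ε ^ 2) * r ^ 2) * r * dr) * h2

end Curve

end NavDomain

/-- The differential of `navRoot`. -/
noncomputable def dNavRoot (ε r a b dr da db : ℝ) : ℝ :=
  ((1 - (1 + ε ^ 2) * r ^ 2) * a / (1 - r ^ 2) * da + r ^ 2 * (1 - r ^ 2) * b * db
    + r * ((1 - 2 * r ^ 2) * b ^ 2 - ε ^ 2 * a ^ 2 / (1 - r ^ 2) ^ 2) * dr) / navRoot ε r a b

/-- The differential of `navMetric`. -/
noncomputable def dNavMetric (ε r a b dr da db : ℝ) : ℝ :=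
  (r * (2 * (1 - r ^ 2) * navMetric ε r a b ^ 2 + (1 - 2 * r ^ 2) * navAngular ε r a b ^ 2) * dr
    + a * da + r ^ 2 * (1 - r ^ 2) * navAngular ε r a b * db) / ((1 - r ^ 2) * navRoot ε r a b)

/-- `dφ` is the differential of `φ` on the navigation domain, tested along curves. -/
def HasNavDifferential (ε : ℝ) (φ : ℝ → ℝ → ℝ → ℝ) (dφ : ℝ → ℝ → ℝ → ℝ → ℝ → ℝ → ℝ) : Prop :=
  ∀ ⦃R A B : ℝ → ℝ⦄ ⦃dr da db t : ℝ⦄, NavDomain ε (R t) (A t) (B t) → HasDerivAt R dr t →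
    HasDerivAt A da t → HasDerivAt B db t →
      HasDerivAt (fun t ↦ φ (R t) (A t) (B t)) (dφ (R t) (A t) (B t) dr da db) t

/-- `f` is given on the navigation domain by a rotation invariant formula. -/
def EqOnNav (ε : ℝ) (f : (Fin 2 → ℝ) → (Fin 2 → ℝ) → ℝ) (φ : ℝ → ℝ → ℝ → ℝ) : Prop :=
  ∀ x y, NavDomain ε (x 0) (y 0) (y 1) → f x y = φ (x 0) (y 0) (y 1)

open Filter Topology in
theorem NavDomain.eventually {ε : ℝ} {R A B : ℝ → ℝ} {t : ℝ} (hR : ContinuousAt R t)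
    (hA : ContinuousAt A t) (hB : ContinuousAt B t) (h : NavDomain ε (R t) (A t) (B t)) :
    ∀ᶠ u in 𝓝 t, NavDomain ε (R u) (A u) (B u) := by
  obtain ⟨hr, hD, hab⟩ := h
  have hD' : ContinuousAt (fun u ↦ 1 - (1 + ε ^ 2) * R u ^ 2) t := by fun_prop
  have hab' : ∀ᶠ u in 𝓝 t, A u ≠ 0 ∨ B u ≠ 0 := by
    rcases hab with h | h
    · exact (hA.eventually_ne h).mono fun _ ↦ Or.inl
    · exact (hB.eventually_ne h).mono fun _ ↦ Or.inr
  filter_upwards [hR.eventually_const_lt hr, hD'.eventually_const_lt hD, hab'] with u h₁ h₂ h₃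
  exact ⟨h₁, h₂, h₃⟩

open Topology in
theorem NavDomain.eventually_radius {ε r a b : ℝ} (h : NavDomain ε r a b) :
    ∀ᶠ u in 𝓝 r, NavDomain ε u a b :=
  NavDomain.eventually (R := fun t ↦ t) (A := fun _ ↦ a) (B := fun _ ↦ b)
    continuousAt_id continuousAt_const continuousAt_const h

namespace EqOnNav

variable {ε : ℝ} {f : (Fin 2 → ℝ) → (Fin 2 → ℝ) → ℝ} {φ : ℝ → ℝ → ℝ → ℝ}
  {dφ : ℝ → ℝ → ℝ → ℝ → ℝ → ℝ → ℝ}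

theorem pdx_zero {ψ : ℝ → ℝ → ℝ → ℝ} (hf : EqOnNav ε f φ)
    (hφ : ∀ r a b, NavDomain ε r a b → HasDerivAt (fun t ↦ φ t a b) (ψ r a b) r) :
    EqOnNav ε (pdx 0 f) ψ := by
  intro x y h
  refine ((hφ _ _ _ h).congr_of_eventuallyEq ?_).deriv
  filter_upwards [h.eventually_radius] with t ht
  simpa using hf (Function.update x 0 t) y (by simpa using ht)

theorem pdy_zero (hf : EqOnNav ε f φ) (hφ : HasNavDifferential ε φ dφ) :
    EqOnNav ε (pdy 0 f) fun r a b ↦ dφ r a b 0 1 0 := by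
  intro x y h
  have key := hφ (R := fun _ ↦ x 0) (A := fun t ↦ t) (B := fun _ ↦ y 1) h
    (hasDerivAt_const _ _) (hasDerivAt_id' _) (hasDerivAt_const _ _)
  refine (key.congr_of_eventuallyEq ?_).deriv
  filter_upwards [NavDomain.eventually (R := fun _ ↦ x 0) (A := fun t ↦ t) (B := fun _ ↦ y 1)
    continuousAt_const continuousAt_id continuousAt_const h] with t ht
  simpa using hf x (Function.update y 0 t) (by simpa using ht)

theorem pdy_one (hf : EqOnNav ε f φ) (hφ : HasNavDifferential ε φ dφ) :
    EqOnNav ε (pdy 1 f) fun r a b ↦ dφ r a b 0 0 1 := by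
  intro x y h
  have key := hφ (R := fun _ ↦ x 0) (A := fun _ ↦ y 0) (B := fun t ↦ t) h
    (hasDerivAt_const _ _) (hasDerivAt_const _ _) (hasDerivAt_id' _)
  refine (key.congr_of_eventuallyEq ?_).deriv
  filter_upwards [NavDomain.eventually (R := fun _ ↦ x 0) (A := fun _ ↦ y 0) (B := fun t ↦ t)
    continuousAt_const continuousAt_const continuousAt_id h] with t ht
  simpa using hf x (Function.update y 1 t) (by simpa using ht)

theorem pdx_one (hf : EqOnNav ε f φ) : EqOnNav ε (pdx 1 f) fun _ _ _ ↦ 0 := by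
  intro x y h
  have hc : (fun t ↦ f (Function.update x 1 t) y) = fun _ ↦ φ (x 0) (y 0) (y 1) := by
    funext t
    simpa using hf (Function.update x 1 t) y (by simpa using h)
  rw [pdx, hc, deriv_const]

theorem congr {ψ : ℝ → ℝ → ℝ → ℝ} (hf : EqOnNav ε f φ)
    (h : ∀ r a b, NavDomain ε r a b → φ r a b = ψ r a b) : EqOnNav ε f ψ :=
  fun x y hxy ↦ (hf x y hxy).trans (h _ _ _ hxy)

end EqOnNav

/-- The half-derivative `½ ∂(F²)/∂μ`. -/
noncomputable def navMomentumZero (ε r a b : ℝ) : ℝ :=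
  navMetric ε r a b * (a / ((1 - r ^ 2) * navRoot ε r a b))

/-- The half-derivative `½ ∂(F²)/∂ν`. -/
noncomputable def navMomentumOne (ε r a b : ℝ) : ℝ :=
  navMetric ε r a b * (r ^ 2 * navAngular ε r a b / navRoot ε r a b)

/-- Differential of `navMomentumZero`. -/
noncomputable def dNavMomentumZero (ε r a b dr da db : ℝ) : ℝ :=
  dNavMetric ε r a b dr da db * (a / ((1 - r ^ 2) * navRoot ε r a b))
    + navMetric ε r a b * ((da + 2 * r * a * dr / (1 - r ^ 2)
        - a * dNavRoot ε r a b dr da db / navRoot ε r a b) / ((1 - r ^ 2) * navRoot ε r a b))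

/-- Differential of `navMomentumOne`. -/
noncomputable def dNavMomentumOne (ε r a b dr da db : ℝ) : ℝ :=
  dNavMetric ε r a b dr da db * (r ^ 2 * navAngular ε r a b / navRoot ε r a b)
    + navMetric ε r a b * ((2 * r * dr * navAngular ε r a b
        + r ^ 2 * (db - ε * dNavMetric ε r a b dr da db)
        - r ^ 2 * navAngular ε r a b * dNavRoot ε r a b dr da db / navRoot ε r a b)
          / navRoot ε r a b)

/-- The component `g₀₀` of the fundamental tensor. -/
noncomputable def navTensorZeroZero (ε r a b : ℝ) : ℝ :=
  (a / ((1 - r ^ 2) * navRoot ε r a b)) ^ 2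
    + navMetric ε r a b * r ^ 2 * b ^ 2 / navRoot ε r a b ^ 3

/-- The component `g₀₁` of the fundamental tensor. -/
noncomputable def navTensorZeroOne (ε r a b : ℝ) : ℝ :=
  (a / ((1 - r ^ 2) * navRoot ε r a b)) * (r ^ 2 * navAngular ε r a b / navRoot ε r a b)
    - navMetric ε r a b * r ^ 2 * a * b / navRoot ε r a b ^ 3

/-- The component `g₁₁` of the fundamental tensor. -/
noncomputable def navTensorOneOne (ε r a b : ℝ) : ℝ :=
  (r ^ 2 * navAngular ε r a b / navRoot ε r a b) ^ 2
    + navMetric ε r a b * r ^ 2 * a ^ 2 / navRoot ε r a b ^ 3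

/-- The radial spray coefficient. -/
noncomputable def navSprayZero (ε r a b : ℝ) : ℝ :=
  r * a ^ 2 / (1 - r ^ 2) - r * navAngular ε r a b ^ 2 / 2

/-- The angular spray coefficient. -/
noncomputable def navSprayOne (ε r a b : ℝ) : ℝ :=
  a * navAngular ε r a b / (r * (1 - r ^ 2))

/-- Differential of `navSprayZero`. -/
noncomputable def dNavSprayZero (ε r a b dr da db : ℝ) : ℝ :=
  (a ^ 2 * (1 + r ^ 2) / (1 - r ^ 2) ^ 2 - navAngular ε r a b ^ 2 / 2) * dr
    + 2 * r * a / (1 - r ^ 2) * da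
    - r * navAngular ε r a b * (db - ε * dNavMetric ε r a b dr da db)

/-- Differential of `navSprayOne`. -/
noncomputable def dNavSprayOne (ε r a b dr da db : ℝ) : ℝ :=
  (da * navAngular ε r a b + a * (db - ε * dNavMetric ε r a b dr da db)
    - a * navAngular ε r a b * (1 - 3 * r ^ 2) / (r * (1 - r ^ 2)) * dr) / (r * (1 - r ^ 2))

/-- The connection coefficient `∂G⁰/∂μ`. -/
noncomputable def navConnZeroZero (ε r a b : ℝ) : ℝ :=
  2 * r * a / (1 - r ^ 2)
    + ε * r * navAngular ε r a b * a / ((1 - r ^ 2) * navRoot ε r a b)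

/-- The connection coefficient `∂G⁰/∂ν`. -/
noncomputable def navConnZeroOne (ε r a b : ℝ) : ℝ :=
  -(r * (1 - r ^ 2) * navAngular ε r a b * navMetric ε r a b / navRoot ε r a b)

/-- The connection coefficient `∂G¹/∂μ`. -/
noncomputable def navConnOneZero (ε r a b : ℝ) : ℝ :=
  navAngular ε r a b / (r * (1 - r ^ 2)) - ε * a ^ 2 / (r * (1 - r ^ 2) ^ 2 * navRoot ε r a b)

/-- The connection coefficient `∂G¹/∂ν`. -/
noncomputable def navConnOneOne (ε r a b : ℝ) : ℝ :=
  a * navMetric ε r a b / (r * navRoot ε r a b)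

/-- Differential of `navConnZeroZero`. -/
noncomputable def dNavConnZeroZero (ε r a b dr da db : ℝ) : ℝ :=
  2 * (1 + r ^ 2) * a / (1 - r ^ 2) ^ 2 * dr + 2 * r / (1 - r ^ 2) * da
    + ε / ((1 - r ^ 2) * navRoot ε r a b) * (navAngular ε r a b * a * (1 + r ^ 2) / (1 - r ^ 2) * dr
      + r * a * (db - ε * dNavMetric ε r a b dr da db) + r * navAngular ε r a b * da
      - r * navAngular ε r a b * a * dNavRoot ε r a b dr da db / navRoot ε r a b)

/-- Differential of `navConnZeroOne`. -/
noncomputable def dNavConnZeroOne (ε r a b dr da db : ℝ) : ℝ :=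
  -(((1 - 3 * r ^ 2) * navAngular ε r a b * navMetric ε r a b * dr
      + r * (1 - r ^ 2) * (db - ε * dNavMetric ε r a b dr da db) * navMetric ε r a b
      + r * (1 - r ^ 2) * navAngular ε r a b * dNavMetric ε r a b dr da db
      - r * (1 - r ^ 2) * navAngular ε r a b * navMetric ε r a b
        * dNavRoot ε r a b dr da db / navRoot ε r a b) / navRoot ε r a b)

/-- Differential of `navConnOneZero`. -/
noncomputable def dNavConnOneZero (ε r a b dr da db : ℝ) : ℝ :=
  ((db - ε * dNavMetric ε r a b dr da db)
      - navAngular ε r a b * (1 - 3 * r ^ 2) / (r * (1 - r ^ 2)) * dr) / (r * (1 - r ^ 2))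
    - ε * a / (r * (1 - r ^ 2) ^ 2 * navRoot ε r a b) * (2 * da
      - a * (1 - 5 * r ^ 2) / (r * (1 - r ^ 2)) * dr
      - a * dNavRoot ε r a b dr da db / navRoot ε r a b)

/-- Differential of `navConnOneOne`. -/
noncomputable def dNavConnOneOne (ε r a b dr da db : ℝ) : ℝ :=
  (da * navMetric ε r a b + a * dNavMetric ε r a b dr da db
    - a * navMetric ε r a b * (dr / r + dNavRoot ε r a b dr da db / navRoot ε r a b))
      / (r * navRoot ε r a b)

namespace HasNavDifferential

theorem hasDerivAt_radius {ε : ℝ} {φ : ℝ → ℝ → ℝ → ℝ} {dφ : ℝ → ℝ → ℝ → ℝ → ℝ → ℝ → ℝ}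
    (hφ : HasNavDifferential ε φ dφ) (r a b : ℝ) (h : NavDomain ε r a b) :
    HasDerivAt (fun t ↦ φ t a b) (dφ r a b 1 0 0) r :=
  hφ (R := fun t ↦ t) (A := fun _ ↦ a) (B := fun _ ↦ b) h (hasDerivAt_id' _)
    (hasDerivAt_const _ _) (hasDerivAt_const _ _)

variable (ε : ℝ)

theorem navMetric : HasNavDifferential ε (navMetric ε) (dNavMetric ε) :=
  fun _ _ _ _ _ _ _ h hR hA hB ↦ h.hasDerivAt_navMetric hR hA hB

theorem navRoot : HasNavDifferential ε (navRoot ε) (dNavRoot ε) :=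
  fun _ _ _ _ _ _ _ h hR hA hB ↦ h.hasDerivAt_navRoot hR hA hB

theorem navAngular : HasNavDifferential ε (navAngular ε)
    fun r a b dr da db ↦ db - ε * dNavMetric ε r a b dr da db :=
  fun _ _ _ _ _ _ _ h hR hA hB ↦ hB.sub ((navMetric ε h hR hA hB).const_mul ε)

theorem navMomentumZero :
    HasNavDifferential ε (navMomentumZero ε) (dNavMomentumZero ε) := by
  intro R A B dr da db t h hR hA hB
  have hw := h.one_sub_sq_pos
  have hs := h.navRoot_pos
  refine ((navMetric ε h hR hA hB).mul
    (hA.div (((hR.pow 2).const_sub 1).mul (navRoot ε h hR hA hB))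
      (mul_pos hw hs).ne')).congr_deriv ?_
  simp only [Pi.mul_apply, Pi.div_apply, Pi.pow_apply, Nat.cast_ofNat, Nat.add_one_sub_one, pow_one,
    dNavMomentumZero]
  generalize 1 - R t ^ 2 = w at *
  field_simp
  ring

theorem navMomentumOne :
    HasNavDifferential ε (navMomentumOne ε) (dNavMomentumOne ε) := by
  intro R A B dr da db t h hR hA hB
  have hs := h.navRoot_pos
  refine ((navMetric ε h hR hA hB).mul
    (((hR.pow 2).mul (navAngular ε h hR hA hB)).div (navRoot ε h hR hA hB)
      hs.ne')).congr_deriv ?_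
  simp only [Pi.mul_apply, Pi.div_apply, Pi.pow_apply, Nat.cast_ofNat, Nat.add_one_sub_one, pow_one,
    dNavMomentumOne]
  field_simp

theorem navSprayZero : HasNavDifferential ε (navSprayZero ε) (dNavSprayZero ε) := by
  intro R A B dr da db t h hR hA hB
  have hw := h.one_sub_sq_pos
  refine (((hR.mul (hA.pow 2)).div ((hR.pow 2).const_sub 1) hw.ne').sub
    ((hR.mul ((navAngular ε h hR hA hB).pow 2)).div_const 2)).congr_deriv ?_
  simp only [Pi.mul_apply, Pi.pow_apply, Nat.cast_ofNat, Nat.add_one_sub_one, pow_one,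
    dNavSprayZero]
  generalize hW : 1 - R t ^ 2 = w at *
  field_simp
  subst hW
  ring

theorem navSprayOne : HasNavDifferential ε (navSprayOne ε) (dNavSprayOne ε) := by
  intro R A B dr da db t h hR hA hB
  have hw := h.one_sub_sq_pos
  have hr := h.1
  refine ((hA.mul (navAngular ε h hR hA hB)).div (hR.mul ((hR.pow 2).const_sub 1))
    (mul_pos hr hw).ne').congr_deriv ?_
  simp only [Pi.mul_apply, Pi.pow_apply, Nat.cast_ofNat, Nat.add_one_sub_one, pow_one,
    dNavSprayOne]
  generalize hW : 1 - R t ^ 2 = w at *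
  field_simp
  subst hW
  ring

theorem navConnZeroZero : HasNavDifferential ε (navConnZeroZero ε) (dNavConnZeroZero ε) := by
  intro R A B dr da db t h hR hA hB
  have hw := h.one_sub_sq_pos
  have hs := h.navRoot_pos
  refine ((((hR.const_mul 2).mul hA).div ((hR.pow 2).const_sub 1) hw.ne').add
    ((((hR.const_mul ε).mul (navAngular ε h hR hA hB)).mul hA).div
      (((hR.pow 2).const_sub 1).mul (navRoot ε h hR hA hB)) (mul_pos hw hs).ne')).congr_deriv ?_
  simp only [Pi.mul_apply, Pi.pow_apply, Nat.cast_ofNat, Nat.add_one_sub_one, pow_one,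
    dNavConnZeroZero]
  generalize hW : 1 - R t ^ 2 = w at *
  field_simp
  subst hW
  ring

theorem navConnZeroOne : HasNavDifferential ε (navConnZeroOne ε) (dNavConnZeroOne ε) := by
  intro R A B dr da db t h hR hA hB
  have hs := h.navRoot_pos
  refine ((((hR.mul ((hR.pow 2).const_sub 1)).mul (navAngular ε h hR hA hB)).mul
    (navMetric ε h hR hA hB)).div (navRoot ε h hR hA hB) hs.ne').neg.congr_deriv ?_
  simp only [Pi.mul_apply, Pi.pow_apply, Nat.cast_ofNat, Nat.add_one_sub_one, pow_one,
    dNavConnZeroOne]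
  field_simp
  ring

theorem navConnOneZero : HasNavDifferential ε (navConnOneZero ε) (dNavConnOneZero ε) := by
  intro R A B dr da db t h hR hA hB
  have hw := h.one_sub_sq_pos
  have hs := h.navRoot_pos
  have hr := h.1
  refine (((navAngular ε h hR hA hB).div (hR.mul ((hR.pow 2).const_sub 1))
    (mul_pos hr hw).ne').sub (((hA.pow 2).const_mul ε).div
      ((hR.mul (((hR.pow 2).const_sub 1).pow 2)).mul (navRoot ε h hR hA hB))
      (mul_pos (mul_pos hr (pow_pos hw 2)) hs).ne')).congr_deriv ?_
  simp only [Pi.mul_apply, Pi.pow_apply, Nat.cast_ofNat, Nat.add_one_sub_one, pow_one,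
    dNavConnOneZero]
  generalize hW : 1 - R t ^ 2 = w at *
  field_simp
  subst hW
  ring

theorem navConnOneOne : HasNavDifferential ε (navConnOneOne ε) (dNavConnOneOne ε) := by
  intro R A B dr da db t h hR hA hB
  have hs := h.navRoot_pos
  have hr := h.1
  refine ((hA.mul (navMetric ε h hR hA hB)).div (hR.mul (navRoot ε h hR hA hB))
    (mul_pos hr hs).ne').congr_deriv ?_
  simp only [Pi.mul_apply, dNavConnOneOne]
  field_simp

theorem navMetric_sq : HasNavDifferential ε (fun r a b ↦ _root_.navMetric ε r a b ^ 2)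
    fun r a b dr da db ↦ 2 * _root_.navMetric ε r a b * dNavMetric ε r a b dr da db :=
  fun _ _ _ _ _ _ _ h hR hA hB ↦ ((navMetric ε h hR hA hB).pow 2).congr_deriv (by simp)

theorem const_mul {ε : ℝ} {φ : ℝ → ℝ → ℝ → ℝ} {dφ : ℝ → ℝ → ℝ → ℝ → ℝ → ℝ → ℝ}
    (hφ : HasNavDifferential ε φ dφ) (c : ℝ) : HasNavDifferential ε (fun r a b ↦ c * φ r a b)
      fun r a b dr da db ↦ c * dφ r a b dr da db :=
  fun _ _ _ _ _ _ _ h hR hA hB ↦ (hφ h hR hA hB).const_mul c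

end HasNavDifferential

theorem NavDomain.dNavRoot_eq {ε r a b dr da db : ℝ} (h : NavDomain ε r a b) :
    dNavRoot ε r a b dr da db =
      (1 - (1 + ε ^ 2) * r ^ 2) * dNavMetric ε r a b dr da db - 2 * r * navMetric ε r a b * dr
        + 2 * ε * r * navAngular ε r a b * dr + ε * r ^ 2 * db := by
  have hw := h.one_sub_sq_pos
  have hs := h.navRoot_pos
  have h1 := h.navRoot_eq
  have h2 := h.navMetric_sq
  have hb : b = navAngular ε r a b + ε * navMetric ε r a b := by unfold navAngular; ring
  unfold dNavRoot dNavMetric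
  generalize navRoot ε r a b = s at *
  generalize navAngular ε r a b = n at *
  generalize navMetric ε r a b = f at *
  subst hb
  generalize hW : 1 - r ^ 2 = w at *
  field_simp
  subst hW h1
  linear_combination (r * ε ^ 2 * dr) * h2

/-- Euler's identity for the degree one function `navMetric`. -/
theorem NavDomain.euler {ε r a b : ℝ} (h : NavDomain ε r a b) :
    a / ((1 - r ^ 2) * navRoot ε r a b) * a + r ^ 2 * navAngular ε r a b / navRoot ε r a b * b
      = navMetric ε r a b := by
  have hw := h.one_sub_sq_pos
  have hs := h.navRoot_pos
  have h1 := h.navRoot_eq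
  have h2 := h.navMetric_sq
  have hb : b = navAngular ε r a b + ε * navMetric ε r a b := by unfold navAngular; ring
  generalize navRoot ε r a b = s at *
  generalize navAngular ε r a b = n at *
  generalize navMetric ε r a b = f at *
  subst hb
  generalize hW : 1 - r ^ 2 = w at *
  field_simp
  subst hW h1
  linear_combination -h2

theorem dNavMomentumZero_mu {ε r a b : ℝ} (h : NavDomain ε r a b) :
    dNavMomentumZero ε r a b 0 1 0 = navTensorZeroZero ε r a b := by
  have hw := h.one_sub_sq_pos
  have hs := h.navRoot_pos
  have h1 := h.navRoot_eq
  have h2 := h.navMetric_sq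
  have hb : b = navAngular ε r a b + ε * navMetric ε r a b := by unfold navAngular; ring
  simp only [dNavMomentumZero, h.dNavRoot_eq, dNavMetric, navTensorZeroZero]
  generalize navRoot ε r a b = s at *
  generalize navAngular ε r a b = n at *
  generalize navMetric ε r a b = f at *
  subst hb
  generalize hW : 1 - r ^ 2 = w at *
  field_simp
  subst hW h1
  linear_combination (f * (1 - (1 + ε ^ 2) * r ^ 2)) * h2

theorem dNavMomentumZero_nu {ε r a b : ℝ} (h : NavDomain ε r a b) :
    dNavMomentumZero ε r a b 0 0 1 = navTensorZeroOne ε r a b := by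
  have hw := h.one_sub_sq_pos
  have hs := h.navRoot_pos
  have h1 := h.navRoot_eq
  have h2 := h.navMetric_sq
  have hb : b = navAngular ε r a b + ε * navMetric ε r a b := by unfold navAngular; ring
  simp only [dNavMomentumZero, h.dNavRoot_eq, dNavMetric, navTensorZeroOne]
  generalize navRoot ε r a b = s at *
  generalize navAngular ε r a b = n at *
  generalize navMetric ε r a b = f at *
  subst hb
  generalize hW : 1 - r ^ 2 = w at *
  field_simp
  subst hW h1
  ring

theorem dNavMomentumOne_mu {ε r a b : ℝ} (h : NavDomain ε r a b) :
    dNavMomentumOne ε r a b 0 1 0 = navTensorZeroOne ε r a b := by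
  have hw := h.one_sub_sq_pos
  have hs := h.navRoot_pos
  have h1 := h.navRoot_eq
  have h2 := h.navMetric_sq
  have hb : b = navAngular ε r a b + ε * navMetric ε r a b := by unfold navAngular; ring
  simp only [dNavMomentumOne, h.dNavRoot_eq, dNavMetric, navTensorZeroOne]
  generalize navRoot ε r a b = s at *
  generalize navAngular ε r a b = n at *
  generalize navMetric ε r a b = f at *
  subst hb
  generalize hW : 1 - r ^ 2 = w at *
  field_simp
  subst hW h1
  ring

theorem dNavMomentumOne_nu {ε r a b : ℝ} (h : NavDomain ε r a b) :
    dNavMomentumOne ε r a b 0 0 1 = navTensorOneOne ε r a b := by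
  have hw := h.one_sub_sq_pos
  have hs := h.navRoot_pos
  have h1 := h.navRoot_eq
  have h2 := h.navMetric_sq
  have hb : b = navAngular ε r a b + ε * navMetric ε r a b := by unfold navAngular; ring
  simp only [dNavMomentumOne, h.dNavRoot_eq, dNavMetric, navTensorOneOne]
  generalize navRoot ε r a b = s at *
  generalize navAngular ε r a b = n at *
  generalize navMetric ε r a b = f at *
  subst hb
  generalize hW : 1 - r ^ 2 = w at *
  field_simp
  subst hW h1
  linear_combination (r ^ 2 * f * (1 - r ^ 2)) * h2

theorem navTensor_zero_spray {ε r a b : ℝ} (h : NavDomain ε r a b) :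
    4 * (navTensorZeroZero ε r a b * navSprayZero ε r a b
      + navTensorZeroOne ε r a b * navSprayOne ε r a b) =
      a * dNavMomentumZero ε r a b 1 0 0 - b * dNavMomentumOne ε r a b 1 0 0 := by
  have hr := h.1
  have hw := h.one_sub_sq_pos
  have hs := h.navRoot_pos
  have h1 := h.navRoot_eq
  have h2 := h.navMetric_sq
  have hb : b = navAngular ε r a b + ε * navMetric ε r a b := by unfold navAngular; ring
  simp only [dNavMomentumZero, dNavMomentumOne, h.dNavRoot_eq, dNavMetric, navTensorZeroZero,
    navTensorZeroOne, navSprayZero, navSprayOne]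
  generalize navRoot ε r a b = s at *
  generalize navAngular ε r a b = n at *
  generalize navMetric ε r a b = f at *
  subst hb
  generalize hW : 1 - r ^ 2 = w at *
  field_simp
  subst hW h1
  linear_combination ((8 * a ^ 2 * r ^ 2 * f - 8 * a ^ 2 * r ^ 2 * n * ε - 8 * a ^ 2 * f - 4 * r
      ^ 6 * f ^ 3 * ε ^ 2 - 4 * r ^ 6 * f ^ 2 * n * ε - 4 * r ^ 6 * f * n ^ 2 * ε ^ 2 - 4 * r ^ 6
      * n ^ 3 * ε + 8 * r ^ 4 * f ^ 3 * ε ^ 2 + 12 * r ^ 4 * f ^ 2 * n * ε + 6 * r ^ 4 * f * n ^ 2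
      * ε ^ 2 + 4 * r ^ 4 * f * n ^ 2 + 6 * r ^ 4 * n ^ 3 * ε - 4 * r ^ 2 * f ^ 3 * ε ^ 2 - 12 * r
      ^ 2 * f ^ 2 * n * ε - 2 * r ^ 2 * f * n ^ 2 * ε ^ 2 - 8 * r ^ 2 * f * n ^ 2 - 2 * r ^ 2 * n
      ^ 3 * ε + 4 * f ^ 2 * n * ε + 4 * f * n ^ 2) * r) * h2

theorem navTensor_one_spray {ε r a b : ℝ} (h : NavDomain ε r a b) :
    4 * (navTensorZeroOne ε r a b * navSprayZero ε r a b
      + navTensorOneOne ε r a b * navSprayOne ε r a b) =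
      2 * a * dNavMomentumOne ε r a b 1 0 0 := by
  have hr := h.1
  have hw := h.one_sub_sq_pos
  have hs := h.navRoot_pos
  have h1 := h.navRoot_eq
  have h2 := h.navMetric_sq
  have hb : b = navAngular ε r a b + ε * navMetric ε r a b := by unfold navAngular; ring
  simp only [dNavMomentumOne, h.dNavRoot_eq, dNavMetric, navTensorOneOne,
    navTensorZeroOne, navSprayZero, navSprayOne]
  generalize navRoot ε r a b = s at *
  generalize navAngular ε r a b = n at *
  generalize navMetric ε r a b = f at *
  subst hb
  generalize hW : 1 - r ^ 2 = w at *
  field_simp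
  subst hW h1
  linear_combination ((-8 * r ^ 4 * f ^ 2 * ε - 8 * r ^ 4 * n ^ 2 * ε + 8 * r ^ 2 * f ^ 2 * ε +
      8 * r ^ 2 * f * n - 8 * f * n) * a) * h2

theorem dNavSprayZero_mu {ε r a b : ℝ} (h : NavDomain ε r a b) :
    dNavSprayZero ε r a b 0 1 0 = navConnZeroZero ε r a b := by
  have hw := h.one_sub_sq_pos
  have hs := h.navRoot_pos
  simp only [dNavSprayZero, dNavMetric, navConnZeroZero]
  field_simp
  ring

theorem dNavSprayZero_nu {ε r a b : ℝ} (h : NavDomain ε r a b) :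
    dNavSprayZero ε r a b 0 0 1 = navConnZeroOne ε r a b := by
  have hw := h.one_sub_sq_pos
  have hs := h.navRoot_pos
  have h1 := h.navRoot_eq
  simp only [dNavSprayZero, dNavMetric, navConnZeroOne]
  generalize navRoot ε r a b = s at *
  generalize navAngular ε r a b = n at *
  generalize navMetric ε r a b = f at *
  generalize hW : 1 - r ^ 2 = w at *
  field_simp
  subst hW h1
  ring

theorem dNavSprayOne_mu {ε r a b : ℝ} (h : NavDomain ε r a b) :
    dNavSprayOne ε r a b 0 1 0 = navConnOneZero ε r a b := by
  have hr := h.1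
  have hw := h.one_sub_sq_pos
  have hs := h.navRoot_pos
  simp only [dNavSprayOne, dNavMetric, navConnOneZero]
  field_simp
  ring

theorem dNavSprayOne_nu {ε r a b : ℝ} (h : NavDomain ε r a b) :
    dNavSprayOne ε r a b 0 0 1 = navConnOneOne ε r a b := by
  have hr := h.1
  have hw := h.one_sub_sq_pos
  have hs := h.navRoot_pos
  have h1 := h.navRoot_eq
  simp only [dNavSprayOne, dNavMetric, navConnOneOne]
  generalize navRoot ε r a b = s at *
  generalize navAngular ε r a b = n at *
  generalize navMetric ε r a b = f at *
  generalize hW : 1 - r ^ 2 = w at *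
  field_simp
  subst hW h1
  ring

theorem navCurvature_zero_zero {ε r a b : ℝ} (h : NavDomain ε r a b) :
    2 * dNavSprayZero ε r a b 1 0 0 - a * dNavConnZeroZero ε r a b 1 0 0
      + 2 * (navSprayZero ε r a b * dNavConnZeroZero ε r a b 0 1 0
        + navSprayOne ε r a b * dNavConnZeroZero ε r a b 0 0 1)
      - (navConnZeroZero ε r a b * navConnZeroZero ε r a b
        + navConnZeroOne ε r a b * navConnOneZero ε r a b) =
      -(navMetric ε r a b ^ 2 - navMetric ε r a b * dNavMetric ε r a b 0 1 0 * a) := by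
  have hr := h.1
  have hw := h.one_sub_sq_pos
  have hs := h.navRoot_pos
  have h1 := h.navRoot_eq
  have h2 := h.navMetric_sq
  have hb : b = navAngular ε r a b + ε * navMetric ε r a b := by unfold navAngular; ring
  simp only [navSprayZero, navSprayOne, dNavSprayZero, dNavConnZeroZero,
    navConnOneZero, navConnZeroOne, navConnZeroZero, h.dNavRoot_eq, dNavMetric]
  generalize navRoot ε r a b = s at *
  generalize navAngular ε r a b = n at *
  generalize navMetric ε r a b = f at *
  subst hb
  generalize hW : 1 - r ^ 2 = w at *
  field_simp
  subst hW h1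
  linear_combination ((2 * a ^ 2 * r ^ 2 * f * ε ^ 2 + 2 * a ^ 2 * r ^ 2 * n * ε - r ^ 6 * f ^ 3
    + 7 * r ^ 6 * f ^ 2 * n * ε - 11 * r ^ 6 * f * n ^ 2 * ε ^ 2 + 5 * r ^ 6 * n ^ 3 * ε ^ 3 + 3
    * r ^ 4 * f ^ 3 - 14 * r ^ 4 * f ^ 2 * n * ε + 11 * r ^ 4 * f * n ^ 2 * ε ^ 2 - 3 * r ^ 2 *
    f ^ 3 + 7 * r ^ 2 * f ^ 2 * n * ε + f ^ 3) * r * (1 - r ^ 2)) * h2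

theorem navCurvature_zero_one {ε r a b : ℝ} (h : NavDomain ε r a b) :
    -(a * dNavConnZeroOne ε r a b 1 0 0)
      + 2 * (navSprayZero ε r a b * dNavConnZeroOne ε r a b 0 1 0
        + navSprayOne ε r a b * dNavConnZeroOne ε r a b 0 0 1)
      - (navConnZeroZero ε r a b * navConnZeroOne ε r a b
        + navConnZeroOne ε r a b * navConnOneOne ε r a b) =
      navMetric ε r a b * dNavMetric ε r a b 0 0 1 * a := by
  have hr := h.1
  have hw := h.one_sub_sq_pos
  have hs := h.navRoot_pos
  have h1 := h.navRoot_eq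
  have h2 := h.navMetric_sq
  have hb : b = navAngular ε r a b + ε * navMetric ε r a b := by unfold navAngular; ring
  simp only [navSprayZero, navSprayOne, dNavConnZeroOne,
    navConnOneOne, navConnZeroOne, navConnZeroZero, h.dNavRoot_eq, dNavMetric]
  generalize navRoot ε r a b = s at *
  generalize navAngular ε r a b = n at *
  generalize navMetric ε r a b = f at *
  subst hb
  generalize hW : 1 - r ^ 2 = w at *
  field_simp
  subst hW h1
  linear_combination ((2 * r ^ 2 * f ^ 2 + 2 * r ^ 2 * n ^ 2 - 2 * f ^ 2) * a * r ^ 3 * ε) * h2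

theorem navCurvature_one_zero {ε r a b : ℝ} (h : NavDomain ε r a b) :
    2 * dNavSprayOne ε r a b 1 0 0 - a * dNavConnOneZero ε r a b 1 0 0
      + 2 * (navSprayZero ε r a b * dNavConnOneZero ε r a b 0 1 0
        + navSprayOne ε r a b * dNavConnOneZero ε r a b 0 0 1)
      - (navConnOneZero ε r a b * navConnZeroZero ε r a b
        + navConnOneOne ε r a b * navConnOneZero ε r a b) =
      navMetric ε r a b * dNavMetric ε r a b 0 1 0 * b := by
  have hr := h.1
  have hw := h.one_sub_sq_pos
  have hs := h.navRoot_pos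
  have h1 := h.navRoot_eq
  have h2 := h.navMetric_sq
  have hb : b = navAngular ε r a b + ε * navMetric ε r a b := by unfold navAngular; ring
  simp only [navSprayZero, navSprayOne, dNavSprayOne, dNavConnOneZero,
    navConnOneOne, navConnOneZero, navConnZeroZero, h.dNavRoot_eq, dNavMetric]
  generalize navRoot ε r a b = s at *
  generalize navAngular ε r a b = n at *
  generalize navMetric ε r a b = f at *
  subst hb
  generalize hW : 1 - r ^ 2 = w at *
  field_simp
  subst hW h1
  linear_combination ((2 * a ^ 2 * r ^ 2 * ε ^ 2 + 2 * a ^ 2 * r ^ 2 - 2 * a ^ 2 + 3 * r ^ 6 * f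
    ^ 2 - 6 * r ^ 6 * f * n * ε + 3 * r ^ 6 * n ^ 2 * ε ^ 2 - 9 * r ^ 4 * f ^ 2 + 12 * r ^ 4 * f
    * n * ε - 3 * r ^ 4 * n ^ 2 * ε ^ 2 + 9 * r ^ 2 * f ^ 2 - 6 * r ^ 2 * f * n * ε - 3 * f ^ 2)
    * a * r ^ 3 * ε) * h2

theorem navCurvature_one_one {ε r a b : ℝ} (h : NavDomain ε r a b) :
    -(a * dNavConnOneOne ε r a b 1 0 0)
      + 2 * (navSprayZero ε r a b * dNavConnOneOne ε r a b 0 1 0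
        + navSprayOne ε r a b * dNavConnOneOne ε r a b 0 0 1)
      - (navConnOneZero ε r a b * navConnZeroOne ε r a b
        + navConnOneOne ε r a b * navConnOneOne ε r a b) =
      -(navMetric ε r a b ^ 2 - navMetric ε r a b * dNavMetric ε r a b 0 0 1 * b) := by
  have hr := h.1
  have hw := h.one_sub_sq_pos
  have hs := h.navRoot_pos
  have h1 := h.navRoot_eq
  have h2 := h.navMetric_sq
  have hb : b = navAngular ε r a b + ε * navMetric ε r a b := by unfold navAngular; ring
  simp only [navSprayZero, navSprayOne, dNavConnOneOne,
    navConnOneOne, navConnOneZero, navConnZeroOne, h.dNavRoot_eq, dNavMetric]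
  generalize navRoot ε r a b = s at *
  generalize navAngular ε r a b = n at *
  generalize navMetric ε r a b = f at *
  subst hb
  generalize hW : 1 - r ^ 2 = w at *
  field_simp
  subst hW h1
  linear_combination ((-2 * a ^ 2 * r ^ 2 * f * ε ^ 2 - 2 * a ^ 2 * r ^ 2 * n * ε - r ^ 6 * f ^
    3 + 2 * r ^ 6 * f ^ 2 * n * ε - r ^ 6 * f * n ^ 2 * ε ^ 2 + 3 * r ^ 4 * f ^ 3 - 4 * r ^ 4 *
    f ^ 2 * n * ε + r ^ 4 * f * n ^ 2 * ε ^ 2 - 3 * r ^ 2 * f ^ 3 + 2 * r ^ 2 * f ^ 2 * n * ε +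
    f ^ 3) * r ^ 3) * h2

section Differentiability

variable {ε r a b : ℝ}

theorem differentiableAt_navTensorZeroZero (h : NavDomain ε r a b) :
    DifferentiableAt ℝ (fun t ↦ navTensorZeroZero ε t a b) r := by
  have hw := h.one_sub_sq_pos.ne'
  have hs := h.navRoot_pos.ne'
  have hF := ((HasNavDifferential.navMetric ε).hasDerivAt_radius r a b h).differentiableAt
  have hS := ((HasNavDifferential.navRoot ε).hasDerivAt_radius r a b h).differentiableAt
  unfold navTensorZeroZero
  fun_prop (disch := positivity)

theorem differentiableAt_navTensorZeroOne (h : NavDomain ε r a b) :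
    DifferentiableAt ℝ (fun t ↦ navTensorZeroOne ε t a b) r := by
  have hw := h.one_sub_sq_pos.ne'
  have hs := h.navRoot_pos.ne'
  have hF := ((HasNavDifferential.navMetric ε).hasDerivAt_radius r a b h).differentiableAt
  have hS := ((HasNavDifferential.navRoot ε).hasDerivAt_radius r a b h).differentiableAt
  have hA := ((HasNavDifferential.navAngular ε).hasDerivAt_radius r a b h).differentiableAt
  unfold navTensorZeroOne
  fun_prop (disch := positivity)

theorem differentiableAt_navTensorOneOne (h : NavDomain ε r a b) :
    DifferentiableAt ℝ (fun t ↦ navTensorOneOne ε t a b) r := by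
  have hs := h.navRoot_pos.ne'
  have hF := ((HasNavDifferential.navMetric ε).hasDerivAt_radius r a b h).differentiableAt
  have hS := ((HasNavDifferential.navRoot ε).hasDerivAt_radius r a b h).differentiableAt
  have hA := ((HasNavDifferential.navAngular ε).hasDerivAt_radius r a b h).differentiableAt
  unfold navTensorOneOne
  fun_prop (disch := positivity)

theorem navTensor_zero_vector (h : NavDomain ε r a b) :
    navTensorZeroZero ε r a b * a + navTensorZeroOne ε r a b * b = navMomentumZero ε r a b := by
  unfold navTensorZeroZero navTensorZeroOne navMomentumZero
  linear_combination (a / ((1 - r ^ 2) * navRoot ε r a b)) * h.euler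

theorem navTensor_one_vector (h : NavDomain ε r a b) :
    navTensorZeroOne ε r a b * a + navTensorOneOne ε r a b * b = navMomentumOne ε r a b := by
  unfold navTensorZeroOne navTensorOneOne navMomentumOne
  linear_combination (r ^ 2 * navAngular ε r a b / navRoot ε r a b) * h.euler

theorem deriv_navTensor_zero_vector (h : NavDomain ε r a b) :
    deriv (fun t ↦ navTensorZeroZero ε t a b) r * a
      + deriv (fun t ↦ navTensorZeroOne ε t a b) r * b = dNavMomentumZero ε r a b 1 0 0 := by
  refine HasDerivAt.unique (((differentiableAt_navTensorZeroZero h).hasDerivAt.mul_const a).add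
    ((differentiableAt_navTensorZeroOne h).hasDerivAt.mul_const b))
    (((HasNavDifferential.navMomentumZero ε).hasDerivAt_radius r a b h).congr_of_eventuallyEq ?_)
  filter_upwards [h.eventually_radius] with t ht using navTensor_zero_vector ht

theorem deriv_navTensor_one_vector (h : NavDomain ε r a b) :
    deriv (fun t ↦ navTensorZeroOne ε t a b) r * a
      + deriv (fun t ↦ navTensorOneOne ε t a b) r * b = dNavMomentumOne ε r a b 1 0 0 := by
  refine HasDerivAt.unique (((differentiableAt_navTensorZeroOne h).hasDerivAt.mul_const a).add
    ((differentiableAt_navTensorOneOne h).hasDerivAt.mul_const b))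
    (((HasNavDifferential.navMomentumOne ε).hasDerivAt_radius r a b h).congr_of_eventuallyEq ?_)
  filter_upwards [h.eventually_radius] with t ht using navTensor_one_vector ht

theorem navTensor_quadratic_pos (h : NavDomain ε r a b) {u v : ℝ} (huv : u ≠ 0 ∨ v ≠ 0) :
    0 < navTensorZeroZero ε r a b * u ^ 2 + 2 * navTensorZeroOne ε r a b * u * v
      + navTensorOneOne ε r a b * v ^ 2 := by
  have hr := h.1
  have hs := h.navRoot_pos
  have hF := h.navMetric_pos
  have he := h.euler
  set p := a / ((1 - r ^ 2) * navRoot ε r a b) with hp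
  set q := r ^ 2 * navAngular ε r a b / navRoot ε r a b with hq
  have key : navTensorZeroZero ε r a b * u ^ 2 + 2 * navTensorZeroOne ε r a b * u * v
      + navTensorOneOne ε r a b * v ^ 2 = (p * u + q * v) ^ 2
        + navMetric ε r a b * r ^ 2 / navRoot ε r a b ^ 3 * (b * u - a * v) ^ 2 := by
    unfold navTensorZeroZero navTensorZeroOne navTensorOneOne
    rw [← hp, ← hq]
    ring
  rw [key]
  by_cases hz : b * u - a * v = 0
  · have hl : p * u + q * v ≠ 0 := by
      intro hl
      have hu : navMetric ε r a b * u = 0 := by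
        rw [← he]; linear_combination a * hl + q * hz
      have hv : navMetric ε r a b * v = 0 := by
        rw [← he]; linear_combination b * hl - p * hz
      rcases huv with h0 | h0
      · exact h0 ((mul_eq_zero.1 hu).resolve_left hF.ne')
      · exact h0 ((mul_eq_zero.1 hv).resolve_left hF.ne')
    positivity
  · positivity

end Differentiability

namespace EqOnNav

variable {ε : ℝ} {F : (Fin 2 → ℝ) → (Fin 2 → ℝ) → ℝ}

theorem pdy_zero_sq (hF : EqOnNav ε F (navMetric ε)) :
    EqOnNav ε (pdy 0 fun x y ↦ F x y ^ 2) fun r a b ↦ 2 * navMomentumZero ε r a b := by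
  have hsq : EqOnNav ε (fun x y ↦ F x y ^ 2) fun r a b ↦ navMetric ε r a b ^ 2 :=
    fun x y h ↦ congrArg (· ^ 2) (hF x y h)
  refine (hsq.pdy_zero (HasNavDifferential.navMetric_sq ε)).congr fun r a b h ↦ ?_
  simp only [dNavMetric, navMomentumZero]
  ring

theorem pdy_one_sq (hF : EqOnNav ε F (navMetric ε)) :
    EqOnNav ε (pdy 1 fun x y ↦ F x y ^ 2) fun r a b ↦ 2 * navMomentumOne ε r a b := by
  have hsq : EqOnNav ε (fun x y ↦ F x y ^ 2) fun r a b ↦ navMetric ε r a b ^ 2 :=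
    fun x y h ↦ congrArg (· ^ 2) (hF x y h)
  refine (hsq.pdy_one (HasNavDifferential.navMetric_sq ε)).congr fun r a b h ↦ ?_
  have hw := h.one_sub_sq_pos
  have hs := h.navRoot_pos
  simp only [dNavMetric, navMomentumOne]
  field_simp
  ring

theorem fundTensor_zero_zero (hF : EqOnNav ε F (navMetric ε)) :
    EqOnNav ε (fundTensor F 0 0) (navTensorZeroZero ε) := fun x y h ↦ by
  have key := hF.pdy_zero_sq.pdy_zero ((HasNavDifferential.navMomentumZero ε).const_mul 2) x y h
  simp only [dNavMomentumZero_mu h] at key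
  rw [fundTensor, key]
  ring

theorem fundTensor_zero_one (hF : EqOnNav ε F (navMetric ε)) :
    EqOnNav ε (fundTensor F 0 1) (navTensorZeroOne ε) := fun x y h ↦ by
  have key := hF.pdy_one_sq.pdy_zero ((HasNavDifferential.navMomentumOne ε).const_mul 2) x y h
  simp only [dNavMomentumOne_mu h] at key
  rw [fundTensor, key]
  ring

theorem fundTensor_one_zero (hF : EqOnNav ε F (navMetric ε)) :
    EqOnNav ε (fundTensor F 1 0) (navTensorZeroOne ε) := fun x y h ↦ by
  have key := hF.pdy_zero_sq.pdy_one ((HasNavDifferential.navMomentumZero ε).const_mul 2) x y h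
  simp only [dNavMomentumZero_nu h] at key
  rw [fundTensor, key]
  ring

theorem fundTensor_one_one (hF : EqOnNav ε F (navMetric ε)) :
    EqOnNav ε (fundTensor F 1 1) (navTensorOneOne ε) := fun x y h ↦ by
  have key := hF.pdy_one_sq.pdy_one ((HasNavDifferential.navMomentumOne ε).const_mul 2) x y h
  simp only [dNavMomentumOne_nu h] at key
  rw [fundTensor, key]
  ring

theorem fundMatrix_eq (hF : EqOnNav ε F (navMetric ε)) {x y : Fin 2 → ℝ}
    (h : NavDomain ε (x 0) (y 0) (y 1)) :
    fundMatrix F x y =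
      !![navTensorZeroZero ε (x 0) (y 0) (y 1), navTensorZeroOne ε (x 0) (y 0) (y 1);
        navTensorZeroOne ε (x 0) (y 0) (y 1), navTensorOneOne ε (x 0) (y 0) (y 1)] := by
  ext i j
  fin_cases i <;> fin_cases j
  · exact hF.fundTensor_zero_zero x y h
  · exact hF.fundTensor_zero_one x y h
  · exact hF.fundTensor_one_zero x y h
  · exact hF.fundTensor_one_one x y h

theorem fundMatrix_posDef (hF : EqOnNav ε F (navMetric ε)) {x y : Fin 2 → ℝ}
    (h : NavDomain ε (x 0) (y 0) (y 1)) : (fundMatrix F x y).PosDef := by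
  rw [hF.fundMatrix_eq h]
  refine Matrix.PosDef.of_dotProduct_mulVec_pos ?_ fun v hv ↦ ?_
  · ext i j
    fin_cases i <;> fin_cases j <;> simp
  · have huv : v 0 ≠ 0 ∨ v 1 ≠ 0 := by
      by_contra! hc
      exact hv (funext fun i ↦ by fin_cases i; exacts [hc.1, hc.2])
    refine (navTensor_quadratic_pos h huv).trans_eq ?_
    simp [Matrix.mulVec, dotProduct, Fin.sum_univ_two]
    ring

theorem lowered_spray (hF : EqOnNav ε F (navMetric ε)) {x y : Fin 2 → ℝ}
    (h : NavDomain ε (x 0) (y 0) (y 1)) :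
    (fun k ↦ ∑ p, ∑ q,
      (2 * pdx q (fundTensor F p k) x y - pdx k (fundTensor F p q) x y) * y p * y q) =
    (fundMatrix F x y).mulVec
      ![4 * navSprayZero ε (x 0) (y 0) (y 1), 4 * navSprayOne ε (x 0) (y 0) (y 1)] := by
  have h00 := hF.fundTensor_zero_zero.pdx_zero
    (fun _ _ _ h ↦ (differentiableAt_navTensorZeroZero h).hasDerivAt) x y h
  have h01 := hF.fundTensor_zero_one.pdx_zero
    (fun _ _ _ h ↦ (differentiableAt_navTensorZeroOne h).hasDerivAt) x y h
  have h10 := hF.fundTensor_one_zero.pdx_zero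
    (fun _ _ _ h ↦ (differentiableAt_navTensorZeroOne h).hasDerivAt) x y h
  have h11 := hF.fundTensor_one_one.pdx_zero
    (fun _ _ _ h ↦ (differentiableAt_navTensorOneOne h).hasDerivAt) x y h
  have hα := deriv_navTensor_zero_vector h
  have hβ := deriv_navTensor_one_vector h
  rw [hF.fundMatrix_eq h]
  funext k
  fin_cases k
  · simp [Matrix.mulVec, dotProduct, Fin.sum_univ_two, hF.fundTensor_zero_zero.pdx_one x y h,
      hF.fundTensor_one_zero.pdx_one x y h, h00, h01, h10, h11]
    linear_combination y 0 * hα - y 1 * hβ - navTensor_zero_spray h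
  · simp [Matrix.mulVec, dotProduct, Fin.sum_univ_two, hF.fundTensor_zero_zero.pdx_one x y h,
      hF.fundTensor_one_zero.pdx_one x y h, hF.fundTensor_zero_one.pdx_one x y h,
      hF.fundTensor_one_one.pdx_one x y h, h01, h11]
    linear_combination 2 * y 0 * hβ - navTensor_one_spray h

theorem sprayCoeff_eq (hF : EqOnNav ε F (navMetric ε)) {x y : Fin 2 → ℝ}
    (h : NavDomain ε (x 0) (y 0) (y 1)) (i : Fin 2) :
    sprayCoeff F i x y =
      ![navSprayZero ε (x 0) (y 0) (y 1), navSprayOne ε (x 0) (y 0) (y 1)] i := by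
  have hdet : IsUnit (fundMatrix F x y).det := (hF.fundMatrix_posDef h).det_pos.ne'.isUnit
  have key := congrArg (fun v ↦ (fundMatrix F x y)⁻¹.mulVec v i) (hF.lowered_spray h)
  simp only [Matrix.mulVec_mulVec, Matrix.nonsing_inv_mul _ hdet, Matrix.one_mulVec] at key
  refine (congrArg (1 / 4 * ·) key).trans ?_
  fin_cases i <;> simp

theorem sprayCoeff_zero (hF : EqOnNav ε F (navMetric ε)) :
    EqOnNav ε (sprayCoeff F 0) (navSprayZero ε) := fun _ _ h ↦ hF.sprayCoeff_eq h 0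

theorem sprayCoeff_one (hF : EqOnNav ε F (navMetric ε)) :
    EqOnNav ε (sprayCoeff F 1) (navSprayOne ε) := fun _ _ h ↦ hF.sprayCoeff_eq h 1

theorem riemCoeff_eq (hF : EqOnNav ε F (navMetric ε)) {x y : Fin 2 → ℝ}
    (h : NavDomain ε (x 0) (y 0) (y 1)) (i k : Fin 2) :
    riemCoeff F i k x y =
      -(F x y ^ 2 * (if i = k then 1 else 0) - F x y * pdy k F x y * y i) := by
  have hP0 := hF.sprayCoeff_zero
  have hP1 := hF.sprayCoeff_one
  have dP0 := HasNavDifferential.navSprayZero ε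
  have dP1 := HasNavDifferential.navSprayOne ε
  have hN00 := (hP0.pdy_zero dP0).congr fun _ _ _ h ↦ dNavSprayZero_mu h
  have hN01 := (hP0.pdy_one dP0).congr fun _ _ _ h ↦ dNavSprayZero_nu h
  have hN10 := (hP1.pdy_zero dP1).congr fun _ _ _ h ↦ dNavSprayOne_mu h
  have hN11 := (hP1.pdy_one dP1).congr fun _ _ _ h ↦ dNavSprayOne_nu h
  have dN00 := HasNavDifferential.navConnZeroZero ε
  have dN01 := HasNavDifferential.navConnZeroOne ε
  have dN10 := HasNavDifferential.navConnOneZero ε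
  have dN11 := HasNavDifferential.navConnOneOne ε
  have hF0 := hF.pdy_zero (HasNavDifferential.navMetric ε) x y h
  have hF1 := hF.pdy_one (HasNavDifferential.navMetric ε) x y h
  fin_cases i <;> fin_cases k
  · simp only [Fin.zero_eta, riemCoeff, Fin.sum_univ_two, hP0 x y h, hP1 x y h,
      hN00 x y h, hN01 x y h, hN10 x y h, hF x y h, hF0, hP0.pdx_zero dP0.hasDerivAt_radius x y h,
      hN00.pdx_zero dN00.hasDerivAt_radius x y h, hN00.pdx_one x y h, hN00.pdy_zero dN00 x y h,
      hN00.pdy_one dN00 x y h, if_true]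
    linear_combination navCurvature_zero_zero h
  · simp only [Fin.zero_eta, Fin.mk_one, riemCoeff, Fin.sum_univ_two, hP0 x y h, hP1 x y h,
      hN00 x y h, hN01 x y h, hN11 x y h, hF x y h, hF1, hP0.pdx_one x y h,
      hN01.pdx_zero dN01.hasDerivAt_radius x y h, hN01.pdx_one x y h, hN01.pdy_zero dN01 x y h,
      hN01.pdy_one dN01 x y h, zero_ne_one, if_false]
    linear_combination navCurvature_zero_one h
  · simp only [Fin.zero_eta, Fin.mk_one, riemCoeff, Fin.sum_univ_two, hP0 x y h, hP1 x y h,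
      hN00 x y h, hN10 x y h, hN11 x y h, hF x y h, hF0,
      hP1.pdx_zero dP1.hasDerivAt_radius x y h,
      hN10.pdx_zero dN10.hasDerivAt_radius x y h, hN10.pdx_one x y h, hN10.pdy_zero dN10 x y h,
      hN10.pdy_one dN10 x y h, one_ne_zero, if_false]
    linear_combination navCurvature_one_zero h
  · simp only [Fin.mk_one, riemCoeff, Fin.sum_univ_two, hP0 x y h, hP1 x y h,
      hN01 x y h, hN10 x y h, hN11 x y h, hF x y h, hF1, hP1.pdx_one x y h,
      hN11.pdx_zero dN11.hasDerivAt_radius x y h, hN11.pdx_one x y h, hN11.pdy_zero dN11 x y h,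
      hN11.pdy_one dN11 x y h, if_true]
    linear_combination navCurvature_one_one h

end EqOnNav

/-- The Randers metric on the disk `D²(1/√(1+ε²))` obtained from Zermelo
navigation on the Klein metric of the unit disk, in polar coordinates
`x = (r,θ)`, `y = (μ,ν)`, has constant flag curvature `K = −1`: its Riemann
curvature satisfies `R^i_k = −(F²δ^i_k − F(∂F/∂y^k)y^i)`. -/
theorem flag_curvature_neg_one_klein_navigation (ε : ℝ)
    (F : (Fin 2 → ℝ) → (Fin 2 → ℝ) → ℝ)
    (hF : F = fun x y =>
      (Real.sqrt ((1 - (1 + ε ^ 2) * (x 0) ^ 2) * (y 0) ^ 2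
            + (x 0) ^ 2 * (1 - (x 0) ^ 2) ^ 2 * (y 1) ^ 2) / Real.sqrt (1 - (x 0) ^ 2)
          - ε * (x 0) ^ 2 * y 1) / (1 - (1 + ε ^ 2) * (x 0) ^ 2)) :
    ∀ x y : Fin 2 → ℝ, 0 < x 0 → x 0 < 1 / Real.sqrt (1 + ε ^ 2) → y ≠ 0 →
      0 < F x y ∧ (fundMatrix F x y).PosDef ∧
      ∀ i k : Fin 2, riemCoeff F i k x y
        = -(F x y ^ 2 * (if i = k then 1 else 0) - F x y * pdy k F x y * y i) := by
  intro x y hr hr' hy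
  have hnav : EqOnNav ε F (navMetric ε) := fun _ _ _ ↦ by rw [hF]; rfl
  have hdom : NavDomain ε (x 0) (y 0) (y 1) := by
    refine ⟨hr, ?_, ?_⟩
    · have hE : 0 < 1 + ε ^ 2 := by positivity
      rw [lt_div_iff₀ (Real.sqrt_pos.2 hE)] at hr'
      have hlt := pow_lt_one₀ (by positivity) hr' two_ne_zero
      rw [mul_pow, Real.sq_sqrt hE.le] at hlt
      linarith
    · by_contra! hc
      exact hy (funext fun i ↦ by fin_cases i; exacts [hc.1, hc.2])
  refine ⟨?_, hnav.fundMatrix_posDef hdom, hnav.riemCoeff_eq hdom⟩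
  rw [hnav x y hdom]
  exact hdom.navMetric_pos
end
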